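/- Let p : ℝ → ℝ be continuous with antiderivative P, and let m, ω ∈ ℝ. Set σ(x,y) = P(x) + mx + iωy and τ(x,y) = −(P(x) + mx) + iωy, and define the bicomplex-valued function pairs F = e^σ, G = e^{−σ}·k and F₁ = e^τ, G₁ = e^{−τ}·k on a domain Ω ⊆ ℝ². Then (F,G) and (F₁,G₁) are generating pairs, (F₁,G₁) is a successor of (F,G), and (F,G) is a successor of (F₁,G₁); in particular (F,G) is embedded in a periodic generating sequence of period 2. Explicitly: a_(F,G) = a_(F₁,G₁) = 0, b_(F₁,G₁) = −B_(F,G), and b_(F,G) = −B_(F₁,G₁). -/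

import Mathlib

open MeasureTheory

/-- Bicomplex numbers: `q = q0 + q1·k` with `q0, q1 : ℂ`, `k² = -1`, `ik = ki`. -/
structure Bicomplex : Type where
  re : ℂ
  im : ℂ

namespace Bicomplex

instance : Zero Bicomplex := ⟨⟨0, 0⟩⟩
instance : One Bicomplex := ⟨⟨1, 0⟩⟩
instance : Add Bicomplex := ⟨fun p q => ⟨p.re + q.re, p.im + q.im⟩⟩
instance : Neg Bicomplex := ⟨fun p => ⟨-p.re, -p.im⟩⟩
instance : Sub Bicomplex := ⟨fun p q => ⟨p.re - q.re, p.im - q.im⟩⟩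
instance : Mul Bicomplex := ⟨fun p q => ⟨p.re * q.re - p.im * q.im, p.re * q.im + p.im * q.re⟩⟩

/-- bicomplex conjugation `q0 + q1·k ↦ q0 - q1·k` -/
def conj (q : Bicomplex) : Bicomplex := ⟨q.re, -q.im⟩

/-- the second imaginary unit `k` -/
def k : Bicomplex := ⟨0, 1⟩

/-- embedding of ℂ into the bicomplex numbers -/
def ofC (z : ℂ) : Bicomplex := ⟨z, 0⟩

/-- bicomplex inverse: `q⁻¹ = q̄/(q0² + q1²)` (junk value if not invertible) -/
noncomputable def inv (q : Bicomplex) : Bicomplex :=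
  ⟨q.re / (q.re ^ 2 + q.im ^ 2), -q.im / (q.re ^ 2 + q.im ^ 2)⟩

/-- the set 𝔖 of bicomplex zero divisors: nonzero `q` with `q·q̄ = q0² + q1² = 0` -/
def zeroDivSet : Set Bicomplex := {q | q ≠ 0 ∧ q.re ^ 2 + q.im ^ 2 = 0}

end Bicomplex

/-- ∂/∂x of a complex-valued function on ℝ² -/
noncomputable def pdx (f : ℝ × ℝ → ℂ) (p : ℝ × ℝ) : ℂ := deriv (fun t => f (t, p.2)) p.1
/-- ∂/∂y of a complex-valued function on ℝ² -/
noncomputable def pdy (f : ℝ × ℝ → ℂ) (p : ℝ × ℝ) : ℂ := deriv (fun t => f (p.1, t)) p.2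
/-- Laplacian Δ = ∂²/∂x² + ∂²/∂y² of a complex-valued function on ℝ² -/
noncomputable def lap (f : ℝ × ℝ → ℂ) (p : ℝ × ℝ) : ℂ := pdx (pdx f) p + pdy (pdy f) p

/-- ∂/∂x of a bicomplex-valued function on ℝ² (componentwise) -/
noncomputable def bpdx (F : ℝ × ℝ → Bicomplex) (p : ℝ × ℝ) : Bicomplex :=
  ⟨pdx (fun q => (F q).re) p, pdx (fun q => (F q).im) p⟩
/-- ∂/∂y of a bicomplex-valued function on ℝ² (componentwise) -/
noncomputable def bpdy (F : ℝ × ℝ → Bicomplex) (p : ℝ × ℝ) : Bicomplex :=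
  ⟨pdy (fun q => (F q).re) p, pdy (fun q => (F q).im) p⟩

/-- `∂̄ = ∂/∂x + k·∂/∂y` -/
noncomputable def dbar (F : ℝ × ℝ → Bicomplex) (p : ℝ × ℝ) : Bicomplex :=
  bpdx F p + Bicomplex.k * bpdy F p

/-- `∂ = ∂/∂x − k·∂/∂y` -/
noncomputable def dz (F : ℝ × ℝ → Bicomplex) (p : ℝ × ℝ) : Bicomplex :=
  bpdx F p - Bicomplex.k * bpdy F p

/-- continuity of a bicomplex-valued function (componentwise) -/
def BContinuousOn (F : ℝ × ℝ → Bicomplex) (Ω : Set (ℝ × ℝ)) : Prop :=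
  ContinuousOn (fun p => (F p).re) Ω ∧ ContinuousOn (fun p => (F p).im) Ω

/-- `C^n` smoothness of a bicomplex-valued function (componentwise) -/
def BContDiffOn (n : ℕ∞) (F : ℝ × ℝ → Bicomplex) (Ω : Set (ℝ × ℝ)) : Prop :=
  ContDiffOn ℝ n (fun p => (F p).re) Ω ∧ ContDiffOn ℝ n (fun p => (F p).im) Ω

/-- characteristic coefficient `a_(F,G)` -/
noncomputable def aCoef (F G : ℝ × ℝ → Bicomplex) (z : ℝ × ℝ) : Bicomplex :=
  -((Bicomplex.conj (F z) * dbar G z - dbar F z * Bicomplex.conj (G z)) *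
    Bicomplex.inv (F z * Bicomplex.conj (G z) - Bicomplex.conj (F z) * G z))
/-- characteristic coefficient `b_(F,G)` -/
noncomputable def bCoef (F G : ℝ × ℝ → Bicomplex) (z : ℝ × ℝ) : Bicomplex :=
  (F z * dbar G z - dbar F z * G z) *
    Bicomplex.inv (F z * Bicomplex.conj (G z) - Bicomplex.conj (F z) * G z)
/-- characteristic coefficient `A_(F,G)` -/
noncomputable def ACoef (F G : ℝ × ℝ → Bicomplex) (z : ℝ × ℝ) : Bicomplex :=
  -((Bicomplex.conj (F z) * dz G z - dz F z * Bicomplex.conj (G z)) *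
    Bicomplex.inv (F z * Bicomplex.conj (G z) - Bicomplex.conj (F z) * G z))
/-- characteristic coefficient `B_(F,G)` -/
noncomputable def BCoef (F G : ℝ × ℝ → Bicomplex) (z : ℝ × ℝ) : Bicomplex :=
  (F z * dz G z - dz F z * G z) *
    Bicomplex.inv (F z * Bicomplex.conj (G z) - Bicomplex.conj (F z) * G z)

/-- `(F,G)` is a generating pair on `Ω` -/
def IsGeneratingPair (F G : ℝ × ℝ → Bicomplex) (Ω : Set (ℝ × ℝ)) : Prop :=
  BContDiffOn 1 F Ω ∧ BContDiffOn 1 G Ω ∧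
    ∀ z ∈ Ω, (Bicomplex.conj (F z) * G z).im ≠ 0

namespace Bicomplex

theorem ext_re_im {p q : Bicomplex} (hre : p.re = q.re) (him : p.im = q.im) : p = q := by
  cases p; cases q; simp_all

@[simp] theorem zero_re : (0 : Bicomplex).re = 0 := rfl
@[simp] theorem zero_im : (0 : Bicomplex).im = 0 := rfl
@[simp] theorem add_re (p q : Bicomplex) : (p + q).re = p.re + q.re := rfl
@[simp] theorem add_im (p q : Bicomplex) : (p + q).im = p.im + q.im := rfl
@[simp] theorem sub_re (p q : Bicomplex) : (p - q).re = p.re - q.re := rfl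
@[simp] theorem sub_im (p q : Bicomplex) : (p - q).im = p.im - q.im := rfl
@[simp] theorem neg_re (p : Bicomplex) : (-p).re = -p.re := rfl
@[simp] theorem neg_im (p : Bicomplex) : (-p).im = -p.im := rfl
@[simp] theorem mul_re (p q : Bicomplex) : (p * q).re = p.re * q.re - p.im * q.im := rfl
@[simp] theorem mul_im (p q : Bicomplex) : (p * q).im = p.re * q.im + p.im * q.re := rfl

end Bicomplex

section ExponentialPair

variable {φ : ℝ × ℝ → ℂ}

theorem isGeneratingPair_exp {Ω : Set (ℝ × ℝ)} (hφ : ContDiff ℝ 1 φ) :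
    IsGeneratingPair (fun z => Bicomplex.ofC (Complex.exp (φ z)))
      (fun z => ⟨0, Complex.exp (-φ z)⟩) Ω := by
  refine ⟨⟨hφ.cexp.contDiffOn, contDiffOn_const⟩,
    ⟨contDiffOn_const, hφ.neg.cexp.contDiffOn⟩, fun z _ => ?_⟩
  simp [Bicomplex.conj, Bicomplex.ofC]

variable {z : ℝ × ℝ} {φx φy : ℂ}

theorem bpdx_ofC_exp (hx : HasDerivAt (fun t => φ (t, z.2)) φx z.1) :
    bpdx (fun w => Bicomplex.ofC (Complex.exp (φ w))) z = ⟨Complex.exp (φ z) * φx, 0⟩ := by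
  simp [bpdx, pdx, Bicomplex.ofC, hx.cexp.deriv]

theorem bpdy_ofC_exp (hy : HasDerivAt (fun t => φ (z.1, t)) φy z.2) :
    bpdy (fun w => Bicomplex.ofC (Complex.exp (φ w))) z = ⟨Complex.exp (φ z) * φy, 0⟩ := by
  simp [bpdy, pdy, Bicomplex.ofC, hy.cexp.deriv]

theorem bpdx_exp_neg_k (hx : HasDerivAt (fun t => φ (t, z.2)) φx z.1) :
    bpdx (fun w => ⟨0, Complex.exp (-φ w)⟩) z = ⟨0, Complex.exp (-φ z) * -φx⟩ := by
  have h := hx.fun_neg.cexp.deriv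
  simp only [bpdx, pdx, h, deriv_const]

theorem bpdy_exp_neg_k (hy : HasDerivAt (fun t => φ (z.1, t)) φy z.2) :
    bpdy (fun w => ⟨0, Complex.exp (-φ w)⟩) z = ⟨0, Complex.exp (-φ z) * -φy⟩ := by
  have h := hy.fun_neg.cexp.deriv
  simp only [bpdy, pdy, h, deriv_const]

theorem aCoef_exp (hx : HasDerivAt (fun t => φ (t, z.2)) φx z.1)
    (hy : HasDerivAt (fun t => φ (z.1, t)) φy z.2) :
    aCoef (fun w => Bicomplex.ofC (Complex.exp (φ w)))
      (fun w => ⟨0, Complex.exp (-φ w)⟩) z = 0 := by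
  simp only [aCoef, dbar, bpdx_ofC_exp hx, bpdy_ofC_exp hy, bpdx_exp_neg_k hx, bpdy_exp_neg_k hy]
  apply Bicomplex.ext_re_im <;>
  · simp [Bicomplex.conj, Bicomplex.ofC, Bicomplex.k, Bicomplex.inv]
    left
    ring

theorem bCoef_exp (hx : HasDerivAt (fun t => φ (t, z.2)) φx z.1)
    (hy : HasDerivAt (fun t => φ (z.1, t)) φy z.2) :
    bCoef (fun w => Bicomplex.ofC (Complex.exp (φ w)))
      (fun w => ⟨0, Complex.exp (-φ w)⟩) z = ⟨φx, φy⟩ := by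
  simp only [bCoef, dbar, bpdx_ofC_exp hx, bpdy_ofC_exp hy, bpdx_exp_neg_k hx, bpdy_exp_neg_k hy]
  have he := Complex.exp_ne_zero (φ z)
  apply Bicomplex.ext_re_im <;>
  · simp [Bicomplex.conj, Bicomplex.ofC, Bicomplex.k, Bicomplex.inv, Complex.exp_neg]
    field_simp
    ring

theorem BCoef_exp (hx : HasDerivAt (fun t => φ (t, z.2)) φx z.1)
    (hy : HasDerivAt (fun t => φ (z.1, t)) φy z.2) :
    BCoef (fun w => Bicomplex.ofC (Complex.exp (φ w)))
      (fun w => ⟨0, Complex.exp (-φ w)⟩) z = ⟨φx, -φy⟩ := by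
  simp only [BCoef, dz, bpdx_ofC_exp hx, bpdy_ofC_exp hy, bpdx_exp_neg_k hx, bpdy_exp_neg_k hy]
  have he := Complex.exp_ne_zero (φ z)
  apply Bicomplex.ext_re_im <;>
  · simp [Bicomplex.conj, Bicomplex.ofC, Bicomplex.k, Bicomplex.inv, Complex.exp_neg]
    field_simp
    ring

end ExponentialPair

/-- with `σ = P(x)+mx+iωy`, `τ = −(P(x)+mx)+iωy`, the pairs
`(F,G) = (e^σ, e^{−σ}k)` and `(F₁,G₁) = (e^τ, e^{−τ}k)` are generating pairs, each is a
successor of the other (so `(F,G)` is embedded in a periodic generating sequence of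
period 2); explicitly `a_(F,G) = a_(F₁,G₁) = 0`, `b_(F₁,G₁) = −B_(F,G)` and
`b_(F,G) = −B_(F₁,G₁)`. -/
theorem periodic_generating_sequence_scalar_potential
    (Ω : Set (ℝ × ℝ)) (hΩo : IsOpen Ω)
    (p : ℝ → ℝ) (hp : Continuous p) (P : ℝ → ℝ) (hP : ∀ x, HasDerivAt P (p x) x)
    (m ω : ℝ) :
    let σ : ℝ × ℝ → ℂ := fun z => ((P z.1 + m * z.1 : ℝ) : ℂ) + Complex.I * ω * z.2
    let τ : ℝ × ℝ → ℂ := fun z => -((P z.1 + m * z.1 : ℝ) : ℂ) + Complex.I * ω * z.2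
    let F : ℝ × ℝ → Bicomplex := fun z => Bicomplex.ofC (Complex.exp (σ z))
    let G : ℝ × ℝ → Bicomplex := fun z => ⟨0, Complex.exp (-σ z)⟩
    let F₁ : ℝ × ℝ → Bicomplex := fun z => Bicomplex.ofC (Complex.exp (τ z))
    let G₁ : ℝ × ℝ → Bicomplex := fun z => ⟨0, Complex.exp (-τ z)⟩
    IsGeneratingPair F G Ω ∧ IsGeneratingPair F₁ G₁ Ω ∧
    (∀ z ∈ Ω, aCoef F G z = 0) ∧ (∀ z ∈ Ω, aCoef F₁ G₁ z = 0) ∧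
    (∀ z ∈ Ω, bCoef F₁ G₁ z = -BCoef F G z) ∧
    (∀ z ∈ Ω, bCoef F G z = -BCoef F₁ G₁ z) := by
  intro σ τ F G F₁ G₁
  have hPC : ContDiff ℝ 1 P := by
    rw [contDiff_one_iff_deriv]
    refine ⟨fun x => (hP x).differentiableAt, ?_⟩
    rwa [show deriv P = p from funext fun x => (hP x).deriv]
  have hre : ContDiff ℝ 1 fun z : ℝ × ℝ => ((P z.1 + m * z.1 : ℝ) : ℂ) :=
    Complex.ofRealCLM.contDiff.comp
      ((hPC.comp contDiff_fst).add (contDiff_const.mul contDiff_fst))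
  have him : ContDiff ℝ 1 fun z : ℝ × ℝ => Complex.I * ω * (z.2 : ℂ) :=
    contDiff_const.mul (Complex.ofRealCLM.contDiff.comp contDiff_snd)
  have hdre (x : ℝ) :
      HasDerivAt (fun t : ℝ => ((P t + m * t : ℝ) : ℂ)) ((p x + m : ℝ) : ℂ) x := by
    simpa using ((hP x).add ((hasDerivAt_id x).const_mul m)).ofReal_comp
  have hdim (y : ℝ) : HasDerivAt (fun t : ℝ => Complex.I * ω * (t : ℂ)) (Complex.I * ω) y := by
    simpa using (hasDerivAt_id y).ofReal_comp.const_mul (Complex.I * ω)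
  have hσx (z : ℝ × ℝ) : HasDerivAt (fun t => σ (t, z.2)) ((p z.1 + m : ℝ) : ℂ) z.1 :=
    (hdre z.1).add_const (Complex.I * ω * z.2)
  have hσy (z : ℝ × ℝ) : HasDerivAt (fun t => σ (z.1, t)) (Complex.I * ω) z.2 :=
    (hdim z.2).const_add ((P z.1 + m * z.1 : ℝ) : ℂ)
  have hτx (z : ℝ × ℝ) : HasDerivAt (fun t => τ (t, z.2)) (-((p z.1 + m : ℝ) : ℂ)) z.1 :=
    (hdre z.1).fun_neg.add_const (Complex.I * ω * z.2)
  have hτy (z : ℝ × ℝ) : HasDerivAt (fun t => τ (z.1, t)) (Complex.I * ω) z.2 :=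
    (hdim z.2).const_add (-((P z.1 + m * z.1 : ℝ) : ℂ))
  refine ⟨isGeneratingPair_exp (hre.add him), isGeneratingPair_exp (hre.neg.add him),
    fun z _ => aCoef_exp (hσx z) (hσy z), fun z _ => aCoef_exp (hτx z) (hτy z),
    fun z _ => ?_, fun z _ => ?_⟩
  · rw [bCoef_exp (hτx z) (hτy z), BCoef_exp (hσx z) (hσy z)]
    apply Bicomplex.ext_re_im <;> simp
  · rw [bCoef_exp (hσx z) (hσy z), BCoef_exp (hτx z) (hτy z)]
    apply Bicomplex.ext_re_im <;> simp
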